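/- Let α ∈ (0,1] and x > 0. If f is three times continuously differentiable on a neighborhood of x, then the third sequential conformable derivative D^{3α} f = D^α(D^α(D^α f)) exists at x and D^{3α} f(x) = x^{3−3α}·f'''(x) + 3(1−α)·x^{2−3α}·f''(x) + (1−α)(1−2α)·x^{1−3α}·f'(x). -/

import Mathlib

open Filter Set MeasureTheory

/-- `f` is α-differentiable at `t` with conformable fractional derivative `L`:
`D^α f(t) = lim_{ε→0} (f(t + ε t^{1-α}) - f t)/ε = L`. -/
def HasConfDerivAt (α : ℝ) (f : ℝ → ℝ) (L t : ℝ) : Prop :=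
  Filter.Tendsto (fun ε : ℝ => (f (t + ε * t ^ (1 - α)) - f t) / ε)
    (nhdsWithin 0 {(0 : ℝ)}ᶜ) (nhds L)

/-- The conformable fractional derivative operator `D^α` (junk value if the limit
does not exist). -/
noncomputable def confDeriv (α : ℝ) (f : ℝ → ℝ) (t : ℝ) : ℝ :=
  limUnder (nhdsWithin 0 {(0 : ℝ)}ᶜ)
    (fun ε : ℝ => (f (t + ε * t ^ (1 - α)) - f t) / ε)

theorem HasDerivAt.hasConfDerivAt {f : ℝ → ℝ} {d t : ℝ} (h : HasDerivAt f d t) (α : ℝ) :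
    HasConfDerivAt α f (t ^ (1 - α) * d) t := by
  have hline : HasDerivAt (fun ε : ℝ => t + ε * t ^ (1 - α)) (t ^ (1 - α)) 0 := by
    simpa using ((hasDerivAt_id (0 : ℝ)).mul_const (t ^ (1 - α))).const_add t
  have hcomp : HasDerivAt (fun ε : ℝ => f (t + ε * t ^ (1 - α))) (d * t ^ (1 - α)) 0 :=
    HasDerivAt.comp (h₂ := f) (0 : ℝ) (by simpa using h) hline
  rw [hasDerivAt_iff_tendsto_slope_zero] at hcomp
  simpa [HasConfDerivAt, div_eq_inv_mul, mul_comm d] using hcomp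

theorem HasDerivAt.confDeriv_eq {f : ℝ → ℝ} {d t : ℝ} (h : HasDerivAt f d t) (α : ℝ) :
    confDeriv α f t = t ^ (1 - α) * d :=
  (h.hasConfDerivAt α).limUnder_eq

theorem sequential_conformable_deriv_three (α x : ℝ) (hα : 0 < α ∧ α ≤ 1) (hx : 0 < x)
    (f : ℝ → ℝ) (s : Set ℝ) (hs : s ∈ nhds x) (hf : ContDiffOn ℝ 3 f s) :
    HasConfDerivAt α (confDeriv α (confDeriv α f))
      (x ^ (3 - 3 * α) * deriv (deriv (deriv f)) x
        + 3 * (1 - α) * x ^ (2 - 3 * α) * deriv (deriv f) x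
        + (1 - α) * (1 - 2 * α) * x ^ (1 - 3 * α) * deriv f x) x := by
  have hf₀ : ContDiffAt ℝ 3 f x := hf.contDiffAt hs
  have hf₁ : ContDiffAt ℝ 2 (deriv f) x := hf₀.derivWithin (by norm_num)
  have hf₂ : ContDiffAt ℝ 1 (deriv (deriv f)) x := hf₁.derivWithin (by norm_num)
  have hd₀ : ∀ᶠ t in nhds x, HasDerivAt f (deriv f t) t :=
    (hf₀.eventually (by simp)).mono fun t ht => (ht.differentiableAt (by simp)).hasDerivAt
  have hd₁ : ∀ᶠ t in nhds x, HasDerivAt (deriv f) (deriv (deriv f) t) t :=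
    (hf₁.eventually (by simp)).mono fun t ht => (ht.differentiableAt (by simp)).hasDerivAt
  have hd₂ : HasDerivAt (deriv (deriv f)) (deriv (deriv (deriv f)) x) x :=
    (hf₂.differentiableAt (by simp)).hasDerivAt
  have hD₁ : ∀ᶠ t in nhds x, confDeriv α f t = t ^ (1 - α) * deriv f t :=
    hd₀.mono fun t ht => ht.confDeriv_eq α
  have hD₂ : confDeriv α (confDeriv α f) =ᶠ[nhds x] fun t =>
      t ^ (1 - α) * ((1 - α) * t ^ (1 - α - 1) * deriv f t
        + t ^ (1 - α) * deriv (deriv f) t) := by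
    filter_upwards [hD₁.eventually_nhds, hd₁, eventually_gt_nhds hx] with t h₁ h₂ ht
    exact (((Real.hasDerivAt_rpow_const (Or.inl ht.ne')).mul h₂).congr_of_eventuallyEq
      h₁).confDeriv_eq α
  have hp (p : ℝ) : HasDerivAt (fun t : ℝ => t ^ p) (p * x ^ (p - 1)) x :=
    Real.hasDerivAt_rpow_const (Or.inl hx.ne')
  have hD₃ := ((((hp (1 - α)).mul ((((hp (1 - α - 1)).const_mul (1 - α)).mul
    hd₁.self_of_nhds).add ((hp (1 - α)).mul hd₂))).congr_of_eventuallyEq hD₂).hasConfDerivAt α)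
  have e₁ : x ^ (1 - α - 1) = x ^ (1 - α) / x := Real.rpow_sub_one hx.ne' _
  have e₂ : x ^ (1 - α - 1 - 1) = x ^ (1 - α) / x / x := by rw [Real.rpow_sub_one hx.ne', e₁]
  have e₃ : x ^ (3 - 3 * α) = (x ^ (1 - α)) ^ 3 := by
    rw [← Real.rpow_mul_natCast hx.le]
    push_cast
    ring_nf
  have e₄ : x ^ (2 - 3 * α) = (x ^ (1 - α)) ^ 3 / x := by
    rw [← e₃, ← Real.rpow_sub_one hx.ne']
    ring_nf
  have e₅ : x ^ (1 - 3 * α) = (x ^ (1 - α)) ^ 3 / x / x := by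
    rw [← e₄, ← Real.rpow_sub_one hx.ne']
    ring_nf
  convert hD₃ using 1
  simp only [Pi.mul_apply, Pi.add_apply, e₁, e₂, e₃, e₄, e₅]
  field_simp
  ring
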